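/- Let C₁, …, C_L be positive definite complex matrices of the same size. Then lim_{p → ∞} Tr{[ C_L^{1/(2p)} ⋯ C₂^{1/(2p)} C₁^{1/p} C₂^{1/(2p)} ⋯ C_L^{1/(2p)} ]^p } = Tr{ exp( log C₁ + log C₂ + ⋯ + log C_L ) } (the multioperator Lie–Trotter product formula), where the p-th power inside the trace is the functional-calculus power of the positive definite matrix C_L^{1/(2p)} ⋯ C₂^{1/(2p)} C₁^{1/p} C₂^{1/(2p)} ⋯ C_L^{1/(2p)}, and the limit is over real p → ∞. -/

import Mathlib

noncomputable section

open Matrix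
open scoped ENNReal ComplexOrder

/-- Functional calculus of a Hermitian complex matrix applied with a complex-valued
function of its (real) eigenvalues. Returns `0` if the matrix is not Hermitian. -/
def hermFC {n : Type*} [Fintype n] [DecidableEq n] (A : Matrix n n ℂ) (f : ℝ → ℂ) :
    Matrix n n ℂ :=
  if hA : A.IsHermitian then
    (hA.eigenvectorUnitary : Matrix n n ℂ) * Matrix.diagonal (f ∘ hA.eigenvalues) *
      (star hA.eigenvectorUnitary : Matrix n n ℂ)
  else 0

/-- Complex power `A ^ z` of a positive semi-definite matrix, defined by functional
calculus on eigenvalues, with eigenvalue `0` mapped to `0`. -/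
def mpow {n : Type*} [Fintype n] [DecidableEq n] (A : Matrix n n ℂ) (z : ℂ) :
    Matrix n n ℂ :=
  hermFC A (fun x => if x = 0 then 0 else (x : ℂ) ^ z)

/-- The Schatten `p`-norm `(Tr |X|^p)^(1/p)` of a complex matrix, where
`|X|^p = (Xᴴ X)^(p/2)` is given by functional calculus. -/
def schattenNorm {n : Type*} [Fintype n] [DecidableEq n] (p : ℝ) (X : Matrix n n ℂ) : ℝ :=
  ((mpow (Xᴴ * X) ((p / 2 : ℝ) : ℂ)).trace).re ^ (1 / p)

/-- The operator norm (largest singular value) of a complex matrix. -/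
def opNorm {n : Type*} [Fintype n] [DecidableEq n] (X : Matrix n n ℂ) : ℝ :=
  ‖Matrix.toEuclideanCLM (𝕜 := ℂ) X‖

/-- Schatten norm with exponent in `[1,∞]`: the operator norm when `p = ∞`. -/
def schattenNormE {n : Type*} [Fintype n] [DecidableEq n] (p : ℝ≥0∞) (X : Matrix n n ℂ) :
    ℝ :=
  if p = ⊤ then opNorm X else schattenNorm p.toReal X

/-- Matrix logarithm of a Hermitian matrix via functional calculus. -/
def mlog {n : Type*} [Fintype n] [DecidableEq n] (A : Matrix n n ℂ) : Matrix n n ℂ :=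
  hermFC A (fun x => ((Real.log x : ℝ) : ℂ))

/-- Matrix exponential of a Hermitian matrix via functional calculus. -/
def mexp {n : Type*} [Fintype n] [DecidableEq n] (A : Matrix n n ℂ) : Matrix n n ℂ :=
  hermFC A (fun x => ((Real.exp x : ℝ) : ℂ))

/-- `α_θ(t) = sin(πθ)/(2(1-θ)[cosh(πt) - cos(πθ)])`. -/
def alphaW (θ t : ℝ) : ℝ :=
  Real.sin (Real.pi * θ) / (2 * (1 - θ) * (Real.cosh (Real.pi * t) - Real.cos (Real.pi * θ)))

/-- `β_θ(t) = sin(πθ)/(2θ[cosh(πt) + cos(πθ)])`. -/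
def betaW (θ t : ℝ) : ℝ :=
  Real.sin (Real.pi * θ) / (2 * θ * (Real.cosh (Real.pi * t) + Real.cos (Real.pi * θ)))

/-- `β₀(t) = π/(2[cosh(πt) + 1])`. -/
def betaZero (t : ℝ) : ℝ := Real.pi / (2 * (Real.cosh (Real.pi * t) + 1))

open scoped Matrix.Norms.L2Operator

/-- The logarithm of the continuous functional calculus has derivative the identity at `1`,
within the selfadjoint elements. -/
theorem hasFDerivWithinAt_cfcLog_one {A : Type*} [NormedRing A] [StarRing A] [NormedAlgebra ℝ A]
    [IsometricContinuousFunctionalCalculus ℝ A IsSelfAdjoint] :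
    HasFDerivWithinAt (CFC.log : A → A) (ContinuousLinearMap.id ℝ A)
      {a | IsSelfAdjoint a} 1 := by
  refine .of_isLittleO (Asymptotics.isLittleO_iff.mpr fun c hc => ?_)
  have hlog := (Real.hasDerivAt_log one_ne_zero).isLittleO
  obtain ⟨ε, hε, hball⟩ := Metric.eventually_nhds_iff.mp (Asymptotics.isLittleO_iff.mp hlog hc)
  filter_upwards [mem_nhdsWithin_of_mem_nhds (Metric.ball_mem_nhds (1 : A) (lt_min hε one_pos)),
    self_mem_nhdsWithin] with a ha hsa
  rw [Metric.mem_ball, dist_eq_norm, lt_min_iff] at ha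
  have hsa : IsSelfAdjoint a := hsa
  have hsub : cfc (fun x : ℝ => x - 1) a = a - 1 := by
    rw [cfc_sub (fun x : ℝ => x) (fun _ => (1 : ℝ)) a, cfc_id' ℝ a, cfc_const_one ℝ a]
  have hspec : ∀ x ∈ spectrum ℝ a, |x - 1| ≤ ‖a - 1‖ := fun x hx => by
    simpa [hsub] using norm_apply_le_norm_cfc (fun x : ℝ => x - 1) a hx
  have hcont : ContinuousOn Real.log (spectrum ℝ a) := fun x hx =>
    (Real.continuousAt_log fun h => by
      have := hspec x hx
      simp only [h, zero_sub, abs_neg, abs_one] at this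
      linarith [ha.2]).continuousWithinAt
  have hdiff : CFC.log a - (a - 1) = cfc (fun x : ℝ => Real.log x - (x - 1)) a := by
    rw [cfc_sub Real.log (fun x : ℝ => x - 1) a, hsub, CFC.log]
  simp only [CFC.log_one, sub_zero, ContinuousLinearMap.id_apply, hdiff]
  refine norm_cfc_le (by positivity) fun x hx => ?_
  have hx' := hspec x hx
  have := hball (y := x) (by rw [Real.dist_eq]; linarith [ha.1])
  simp only [Real.log_one, sub_zero, inv_one, smul_eq_mul, mul_one, Real.norm_eq_abs] at this ⊢
  exact this.trans (mul_le_mul_of_nonneg_left hx' hc.le)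

theorem hasDerivAt_prod_exp_smul_zero {A : Type*} [NormedRing A] [NormedAlgebra ℝ A]
    [CompleteSpace A] (l : List A) :
    HasDerivAt (fun t : ℝ => (l.map fun h => NormedSpace.exp (t • h)).prod) l.sum 0 := by
  induction l with
  | nil => simpa using hasDerivAt_const (0 : ℝ) (1 : A)
  | cons h l ih =>
    simpa [Pi.mul_def] using (hasDerivAt_exp_smul_const (𝕂 := ℝ) h 0).mul ih

section

variable {n : Type*} [Fintype n] [DecidableEq n]

theorem hermFC_congr (A : Matrix n n ℂ) {f g : ℝ → ℂ}
    (h : ∀ hA : A.IsHermitian, ∀ i, f (hA.eigenvalues i) = g (hA.eigenvalues i)) :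
    hermFC A f = hermFC A g := by
  unfold hermFC
  split_ifs with hA
  · rw [show f ∘ hA.eigenvalues = g ∘ hA.eigenvalues from funext (h hA)]
  · rfl

theorem hermFC_ofReal {A : Matrix n n ℂ} (hA : A.IsHermitian) (f : ℝ → ℝ) :
    hermFC A (fun x => (f x : ℂ)) = cfc f A := by
  rw [hA.cfc_eq, Matrix.IsHermitian.cfc, hermFC, dif_pos hA, Unitary.conjStarAlgAut_apply]
  rfl

theorem mlog_eq_cfcLog {A : Matrix n n ℂ} (hA : A.IsHermitian) : mlog A = CFC.log A :=
  hermFC_ofReal hA Real.log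

theorem mexp_eq_exp {A : Matrix n n ℂ} (hA : A.IsHermitian) : mexp A = NormedSpace.exp A :=
  (hermFC_ofReal hA Real.exp).trans (CFC.real_exp_eq_normedSpace_exp hA.isSelfAdjoint)

theorem mpow_ofReal_eq_exp {A : Matrix n n ℂ} (hA : A.PosDef) (t : ℝ) :
    mpow A (t : ℂ) = NormedSpace.exp (t • CFC.log A) := by
  have hspec : ∀ x ∈ spectrum ℝ A, x ≠ 0 := fun x hx h =>
    spectrum.zero_notMem ℝ hA.isUnit (h ▸ hx)
  have hsa : IsSelfAdjoint A := hA.isHermitian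
  have hlog : ContinuousOn Real.log (spectrum ℝ A) := Real.continuousOn_log.mono hspec
  have hmul : t • CFC.log A = cfc (fun x => t * Real.log x) A :=
    (cfc_const_mul t Real.log A hlog).symm
  have hcomp : cfc (fun x => Real.exp (t * Real.log x)) A = NormedSpace.exp (t • CFC.log A) := by
    rw [cfc_comp' Real.exp (fun x => t * Real.log x) A (by fun_prop) (by fun_prop), ← hmul]
    exact CFC.real_exp_eq_normedSpace_exp ((IsSelfAdjoint.all t).smul .log)
  rw [← hcomp, ← hermFC_ofReal hA.isHermitian, mpow]
  refine hermFC_congr A fun _ i => ?_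
  have hpos := hA.eigenvalues_pos i
  rw [if_neg hpos.ne', ← Complex.ofReal_cpow hpos.le, Real.rpow_def_of_pos hpos, mul_comm]

theorem posDef_exp {A : Matrix n n ℂ} (hA : A.IsHermitian) : (NormedSpace.exp A).PosDef := by
  open scoped MatrixOrder in
  exact (Matrix.nonneg_iff_posSemidef.mp hA.isSelfAdjoint.exp_nonneg).posDef_iff_isUnit.mpr
    (Matrix.isUnit_exp A)

/-- A palindromic product of exponentials of Hermitian matrices is positive definite. -/
theorem posDef_prod_exp {l : List (Matrix n n ℂ)} (hl : ∀ h ∈ l, h.IsHermitian)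
    {A : Matrix n n ℂ} (hA : A.IsHermitian) :
    ((l.reverse ++ [A] ++ l).map NormedSpace.exp).prod.PosDef := by
  induction l using List.reverseRecOn with
  | nil => simpa using posDef_exp hA
  | append_singleton l a ih =>
    have ha : (NormedSpace.exp a).PosDef := posDef_exp (hl a (by simp))
    have := (Matrix.IsUnit.posDef_star_left_conjugate_iff (Matrix.isUnit_exp a)).mpr
      (ih fun h hh => hl h (by simp [hh]))
    rw [Matrix.star_eq_conjTranspose, ha.isHermitian.eq] at this
    simpa [mul_assoc] using this

end

/-- multioperator Lie–Trotter product formula. For positive definite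
matrices `C₁, …, C_L` (here `L = L'+1`, with `C₁ = C 0`), as real `p → ∞`,
`Tr{[C_L^{1/(2p)} ⋯ C₂^{1/(2p)} C₁^{1/p} C₂^{1/(2p)} ⋯ C_L^{1/(2p)}]^p}` tends to
`Tr{exp(log C₁ + ⋯ + log C_L)}`. -/
theorem trace_symmetrized_power_tendsto_trace_exp_sum_log
    {n : Type*} [Fintype n] [DecidableEq n] (L : ℕ)
    (C : Fin (L + 1) → Matrix n n ℂ) (hC : ∀ i, (C i).PosDef) :
    Filter.Tendsto (fun p : ℝ =>
      (mpow
        ((List.ofFn fun i : Fin L =>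
            mpow (C i.succ) ((1 / (2 * p) : ℝ) : ℂ)).reverse.prod *
          mpow (C 0) ((1 / p : ℝ) : ℂ) *
          (List.ofFn fun i : Fin L =>
            mpow (C i.succ) ((1 / (2 * p) : ℝ) : ℂ)).prod)
        ((p : ℝ) : ℂ)).trace)
      Filter.atTop (nhds ((mexp (∑ i, mlog (C i))).trace)) := by
  set l : List (Matrix n n ℂ) := List.ofFn fun i : Fin L => (1 / 2 : ℝ) • CFC.log (C i.succ)
    with hl_def
  set S : ℝ → Matrix n n ℂ := fun t =>
    ((l.reverse ++ [CFC.log (C 0)] ++ l).map fun h => NormedSpace.exp (t • h)).prod with hS_def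
  have hlog : ∀ i, (CFC.log (C i)).IsHermitian := fun i => IsSelfAdjoint.log
  have hsmul : ∀ (t : ℝ) {H : Matrix n n ℂ}, H.IsHermitian → (t • H).IsHermitian :=
    fun t _ hH => (IsSelfAdjoint.all t).smul hH.isSelfAdjoint
  have hSpos : ∀ t, (S t).PosDef := fun t => by
    have := posDef_prod_exp (l := l.map (t • ·)) (A := t • CFC.log (C 0)) (fun h hh => by
      simp only [hl_def, List.mem_map, List.mem_ofFn] at hh
      obtain ⟨_, ⟨i, rfl⟩, rfl⟩ := hh
      exact hsmul t (hsmul _ (hlog _))) (hsmul t (hlog 0))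
    simpa [hS_def, Function.comp_def] using this
  have hS0 : S 0 = 1 := by simp [hS_def]
  have hsum : (l.reverse ++ [CFC.log (C 0)] ++ l).sum = ∑ i, mlog (C i) := by
    have hl : l.sum + l.sum = ∑ i : Fin L, CFC.log (C i.succ) := by
      rw [hl_def, List.sum_ofFn, ← Finset.sum_add_distrib]
      exact Finset.sum_congr rfl fun i _ => by rw [← add_smul]; norm_num
    simp only [Fin.sum_univ_succ, mlog_eq_cfcLog (hC _).isHermitian, List.sum_append,
      List.sum_reverse, List.sum_singleton, ← hl]
    abel
  have hderiv : HasDerivAt S (∑ i, mlog (C i)) 0 := hsum ▸ hasDerivAt_prod_exp_smul_zero _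
  have hlogderiv : HasDerivAt (fun t => CFC.log (S t)) (∑ i, mlog (C i)) 0 := by
    rw [← hasDerivWithinAt_univ]
    exact (hS0 ▸ hasFDerivWithinAt_cfcLog_one :
      HasFDerivWithinAt CFC.log (ContinuousLinearMap.id ℝ (Matrix n n ℂ))
        {a | IsSelfAdjoint a} (S 0)).comp_hasDerivWithinAt 0 hderiv.hasDerivWithinAt
        fun t _ => (hSpos t).isHermitian
  have hslope : Filter.Tendsto (fun p : ℝ => p • CFC.log (S (1 / p))) Filter.atTop
      (nhds (∑ i, mlog (C i))) := by
    have h := hlogderiv.tendsto_slope_zero.comp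
      (tendsto_inv_atTop_nhdsGT_zero.mono_right (nhdsWithin_mono _ fun _ hx => ne_of_gt hx))
    simpa [Function.comp_def, hS0] using h
  have hexp : mexp (∑ i, mlog (C i)) = NormedSpace.exp (∑ i, mlog (C i)) := by
    refine mexp_eq_exp ?_
    simp only [mlog_eq_cfcLog (hC _).isHermitian]
    exact isSelfAdjoint_sum _ fun i _ => hlog i
  rw [hexp]
  let +nondep : NormedAlgebra ℚ (Matrix n n ℂ) := .restrictScalars ℚ ℂ _
  have htrace : Continuous fun A : Matrix n n ℂ => (NormedSpace.exp A).trace :=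
    (NormedSpace.exp_continuous (𝔸 := Matrix n n ℂ)).matrix_trace
  refine ((htrace.tendsto _).comp hslope).congr fun p => ?_
  rw [Function.comp_apply, ← mpow_ofReal_eq_exp (hSpos _)]
  congr 2
  have hhalf : (fun i : Fin L => mpow (C i.succ) ((1 / (2 * p) : ℝ) : ℂ)) =
      fun i => NormedSpace.exp ((1 / p) • (1 / 2 : ℝ) • CFC.log (C i.succ)) := by
    funext i
    rw [mpow_ofReal_eq_exp (hC _), smul_smul, one_div_mul_one_div, mul_comm p]
  rw [hhalf, mpow_ofReal_eq_exp (hC 0)]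
  simp only [hS_def, hl_def, List.map_append, List.prod_append, List.map_reverse, List.map_ofFn,
    List.map_cons, List.map_nil, List.prod_singleton, Function.comp_def]
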